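/- Thompson's group V has trivial center. -/

import Mathlib

/-- Prepend a finite binary word `u` to an infinite binary sequence `x`. -/
def seqAppend (u : List Bool) (x : ℕ → Bool) : ℕ → Bool :=
  fun n => if n < u.length then u.getD n false else x (n - u.length)

/-- A finite set `U` of finite binary words is a complete prefix code if every
point of Cantor space `ℕ → Bool` has a unique prefix in `U`, i.e. the cylinders
`[u]`, `u ∈ U`, partition Cantor space. -/
def IsCompletePrefixCode (U : Finset (List Bool)) : Prop :=
  ∀ x : ℕ → Bool, ∃! u : List Bool, u ∈ U ∧ ∃ y : ℕ → Bool, x = seqAppend u y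

/-- Membership in Thompson's group `V`, viewed inside the permutations of Cantor
space: `f` is of the form `f_φ` for a bijection `φ : A → B` between two complete
prefix codes, replacing the unique prefix in `A` by its `φ`-image. (Any such map
is automatically a homeomorphism.) -/
def InThompsonV (f : Equiv.Perm (ℕ → Bool)) : Prop :=
  ∃ (A B : Finset (List Bool)) (_ : IsCompletePrefixCode A)
    (_ : IsCompletePrefixCode B) (e : {u // u ∈ A} ≃ {v // v ∈ B}),
    ∀ (u : {u // u ∈ A}) (x : ℕ → Bool), f (seqAppend u.1 x) = seqAppend (e u).1 x

/-- The finite set of binary words of length `m`. -/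
def wordsOfLength (m : ℕ) : Finset (List Bool) :=
  Finset.univ.image fun w : Fin m → Bool => List.ofFn w

lemma mem_wordsOfLength {m : ℕ} {u : List Bool} : u ∈ wordsOfLength m ↔ u.length = m := by
  constructor
  · intro h
    obtain ⟨w, -, rfl⟩ := Finset.mem_image.1 h
    simp
  · rintro rfl
    exact Finset.mem_image.2 ⟨u.get, Finset.mem_univ _, List.ofFn_get u⟩

lemma isCompletePrefixCode_wordsOfLength (m : ℕ) :
    IsCompletePrefixCode (wordsOfLength m) := by
  intro x
  refine ⟨List.ofFn fun i : Fin m => x i,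
    ⟨mem_wordsOfLength.2 (by simp), fun k => x (k + m), ?_⟩, ?_⟩
  · funext k
    by_cases hk : k < m
    · simp [seqAppend, hk]
    · simp [seqAppend, hk, Nat.sub_add_cancel (not_lt.1 hk)]
  · rintro v ⟨hv, y, rfl⟩
    rw [mem_wordsOfLength] at hv
    refine List.ext_getElem (by simp [hv]) fun i hi _ => ?_
    simp [seqAppend, hi]

/-- Flip the letter at position `n + 1` of a sequence whose letter at position `n` is `b`. -/
def flipAfter (n : ℕ) (b : Bool) (z : ℕ → Bool) : ℕ → Bool :=
  fun k => if k = n + 1 then xor (z k) (z n == b) else z k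

lemma flipAfter_involutive (n : ℕ) (b : Bool) : Function.Involutive (flipAfter n b) := by
  intro z
  funext k
  by_cases hk : k = n + 1 <;> simp [flipAfter, hk]

/-- Flip the letter at position `n + 1` of a word whose letter at position `n` is `b`. -/
def wordFlipAfter (n : ℕ) (b : Bool) (u : List Bool) : List Bool :=
  u.set (n + 1) (xor (u.getD (n + 1) false) (u.getD n false == b))

lemma wordFlipAfter_length (n : ℕ) (b : Bool) (u : List Bool) :
    (wordFlipAfter n b u).length = u.length := by
  simp [wordFlipAfter]

lemma wordFlipAfter_involutive (n : ℕ) (b : Bool) :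
    Function.Involutive (wordFlipAfter n b) := by
  intro u
  refine List.ext_getElem (by simp [wordFlipAfter_length]) fun i _ hi => ?_
  by_cases hk : n + 1 = i
  · subst hk
    simp [wordFlipAfter, hi]
  · simp [wordFlipAfter, hk]

lemma flipAfter_seqAppend {n : ℕ} (b : Bool) {u : List Bool} (hu : n + 1 < u.length)
    (x : ℕ → Bool) :
    flipAfter n b (seqAppend u x) = seqAppend (wordFlipAfter n b u) x := by
  have hn : n < u.length := by omega
  funext k
  by_cases hk : k = n + 1
  · subst hk
    simp [flipAfter, seqAppend, wordFlipAfter, hu, hn]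
  · simp [flipAfter, seqAppend, wordFlipAfter, hk, Ne.symm hk]

lemma inThompsonV_flipAfter (n : ℕ) (b : Bool) :
    InThompsonV (flipAfter_involutive n b).toPerm := by
  refine ⟨wordsOfLength (n + 2), wordsOfLength (n + 2), isCompletePrefixCode_wordsOfLength _,
    isCompletePrefixCode_wordsOfLength _,
    (wordFlipAfter_involutive n b).toPerm.subtypeEquiv fun u => ?_, fun u x => ?_⟩
  · simp [mem_wordsOfLength, wordFlipAfter_length]
  · have hu := mem_wordsOfLength.1 u.2
    exact flipAfter_seqAppend b (by omega) x

/-- Thompson's group `V` has trivial center: any element of `V`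
commuting with every element of `V` is the identity. -/
theorem thompsonV_center_trivial :
    ∀ f : Equiv.Perm (ℕ → Bool), InThompsonV f →
      (∀ g : Equiv.Perm (ℕ → Bool), InThompsonV g → f * g = g * f) → f = 1 := by
  intro f _ hcomm
  ext1 x
  by_contra hne
  obtain ⟨n, hn⟩ := Function.ne_iff.1 hne
  change f x n ≠ x n at hn
  have hx : flipAfter n (f x n) x = x := by
    funext k
    have hb : (x n == f x n) = false := beq_false_of_ne hn.symm
    simp [flipAfter, hb]
  have hfix : f (flipAfter n (f x n) x) = flipAfter n (f x n) (f x) :=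
    DFunLike.congr_fun (hcomm _ (inThompsonV_flipAfter n (f x n))) x
  rw [hx] at hfix
  simpa [flipAfter] using congrFun hfix (n + 1)
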